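/- arXiv:2307.15510 — 5 statements merged into one kernel-verified Lean document; each statement's English description precedes it below -/
import Mathlib

section
/- Let T > 0, ρ > 0, Ω > 0, Ū > 0, and let N ≥ 2 be a natural number. Let w, π : ℕ → ℝ² satisfy ‖w(k)‖ ≤ TρΩ and ‖π(k)‖ ≤ 2Ū for all k, and define v(k) = w(k) + T·π(k). Fix l ∈ ℕ and suppose there exist indices k₁, k₂ with l ≤ k₁ < k₂ ≤ l + N − 1 and real numbers 0 < λ_min ≤ λ_max such that for every unit vector x ∈ ℝ², λ_min² ≤ ⟨w(k₁), x⟩² + ⟨w(k₂), x⟩² ≤ λ_max². If 2√2·T·Ū < λ_max − √(λ_max² − λ_min²), then there exist constants α₁, α₂ with 0 < α₁ ≤ α₂ = N·T²·(ρΩ + 2Ū)² such that for every unit vector x ∈ ℝ², α₁ ≤ Σ_{k=l}^{l+N−1} ⟨v(k), x⟩² ≤ α₂ (i.e., the sequence v satisfies a persistent excitation condition on the window {l, …, l+N−1}). -/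
open scoped RealInnerProductSpace

theorem pe_aux (a b p q m D : ℝ) (hm : 0 ≤ m) (hD : 0 ≤ D) (hDm : D ≤ m)
    (h1 : m ^ 2 ≤ a ^ 2 + b ^ 2) (h2 : p ^ 2 + q ^ 2 ≤ D ^ 2) :
    (m - D) ^ 2 ≤ (a + p) ^ 2 + (b + q) ^ 2 := by
  obtain ⟨A, hA0, hA⟩ : ∃ A : ℝ, 0 ≤ A ∧ A ^ 2 = a ^ 2 + b ^ 2 :=
    ⟨Real.sqrt (a ^ 2 + b ^ 2), Real.sqrt_nonneg _, Real.sq_sqrt (by positivity)⟩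
  obtain ⟨P, hP0, hP⟩ : ∃ P : ℝ, 0 ≤ P ∧ P ^ 2 = p ^ 2 + q ^ 2 :=
    ⟨Real.sqrt (p ^ 2 + q ^ 2), Real.sqrt_nonneg _, Real.sq_sqrt (by positivity)⟩
  have hAm : m ≤ A := abs_le_of_sq_le_sq' (by linarith) hA0 |>.2
  have hPD : P ≤ D := abs_le_of_sq_le_sq' (by linarith) hD |>.2
  have hcs : -(A * P) ≤ a * p + b * q := by
    refine (abs_le_of_sq_le_sq' ?_ (mul_nonneg hA0 hP0)).1
    rw [mul_pow, hA, hP]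
    nlinarith [sq_nonneg (a * q - b * p)]
  have h3 : (m - D) ^ 2 ≤ (A - P) ^ 2 :=
    pow_le_pow_left₀ (by linarith) (by linarith) 2
  nlinarith

/-- Persistent excitation of the relative displacements `v k = w k + T • φ k` on the
window `{l, …, l+N-1}` (Theorem 1 of the paper). -/
theorem persistent_excitation_window
    (T ρ Ω Ubar : ℝ) (hT : 0 < T) (hρ : 0 < ρ) (hΩ : 0 < Ω) (hU : 0 < Ubar)
    (N : ℕ) (hN : 2 ≤ N)
    (w φ v : ℕ → EuclideanSpace ℝ (Fin 2))
    (hw : ∀ k, ‖w k‖ ≤ T * ρ * Ω) (hφ : ∀ k, ‖φ k‖ ≤ 2 * Ubar)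
    (hv : ∀ k, v k = w k + T • φ k)
    (l k₁ k₂ : ℕ) (hlk₁ : l ≤ k₁) (hk₁₂ : k₁ < k₂) (hk₂ : k₂ ≤ l + N - 1)
    (lmin lmax : ℝ) (hlmin : 0 < lmin) (hminmax : lmin ≤ lmax)
    (hsv : ∀ x : EuclideanSpace ℝ (Fin 2), ‖x‖ = 1 →
      lmin ^ 2 ≤ ⟪w k₁, x⟫ ^ 2 + ⟪w k₂, x⟫ ^ 2 ∧
      ⟪w k₁, x⟫ ^ 2 + ⟪w k₂, x⟫ ^ 2 ≤ lmax ^ 2)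
    (hTsmall : 2 * Real.sqrt 2 * T * Ubar < lmax - Real.sqrt (lmax ^ 2 - lmin ^ 2)) :
    ∃ α₁ α₂ : ℝ, 0 < α₁ ∧ α₁ ≤ α₂ ∧ α₂ = N * T ^ 2 * (ρ * Ω + 2 * Ubar) ^ 2 ∧
      ∀ x : EuclideanSpace ℝ (Fin 2), ‖x‖ = 1 →
        α₁ ≤ ∑ k ∈ Finset.Icc l (l + N - 1), ⟪v k, x⟫ ^ 2 ∧
        ∑ k ∈ Finset.Icc l (l + N - 1), ⟪v k, x⟫ ^ 2 ≤ α₂ := by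
  have hs : lmax - lmin ≤ Real.sqrt (lmax ^ 2 - lmin ^ 2) := by
    apply Real.le_sqrt_of_sq_le
    nlinarith
  set D := 2 * Real.sqrt 2 * T * Ubar with hDdef
  have hD0 : 0 ≤ D := by positivity
  have hD2 : D ^ 2 = 2 * (T * (2 * Ubar)) ^ 2 := by
    have := Real.sq_sqrt (show (0 : ℝ) ≤ 2 by norm_num)
    rw [hDdef]
    calc _ = (Real.sqrt 2) ^ 2 * (2 * T * Ubar) ^ 2 := by ring
      _ = _ := by rw [this]; ring
  have hDm : D < lmin := by linarith
  have hp : ∀ k, ∀ x : EuclideanSpace ℝ (Fin 2), ‖x‖ = 1 →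
      ⟪T • φ k, x⟫ ^ 2 ≤ (T * (2 * Ubar)) ^ 2 := by
    intro k x hx
    rw [← sq_abs]
    refine pow_le_pow_left₀ (abs_nonneg _) ?_ 2
    refine (abs_real_inner_le_norm _ _).trans ?_
    rw [hx, mul_one, norm_smul, Real.norm_of_nonneg hT.le]
    exact mul_le_mul_of_nonneg_left (hφ k) hT.le
  have key : ∀ x : EuclideanSpace ℝ (Fin 2), ‖x‖ = 1 →
      (lmin - D) ^ 2 ≤ ∑ k ∈ Finset.Icc l (l + N - 1), ⟪v k, x⟫ ^ 2 ∧
      ∑ k ∈ Finset.Icc l (l + N - 1), ⟪v k, x⟫ ^ 2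
        ≤ N * T ^ 2 * (ρ * Ω + 2 * Ubar) ^ 2 := by
    intro x hx
    constructor
    · have h1 := pe_aux _ _ ⟪T • φ k₁, x⟫ ⟪T • φ k₂, x⟫ lmin D hlmin.le hD0 hDm.le (hsv x hx).1
        (by have := hp k₁ x hx
            have := hp k₂ x hx
            linarith)
      rw [← inner_add_left, ← inner_add_left, ← hv, ← hv] at h1
      refine h1.trans ?_
      rw [← Finset.sum_pair (f := fun k => ⟪v k, x⟫ ^ 2) hk₁₂.ne]
      refine Finset.sum_le_sum_of_subset_of_nonneg ?_ (fun _ _ _ => sq_nonneg _)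
      intro k hk
      simp only [Finset.mem_insert, Finset.mem_singleton] at hk
      rw [Finset.mem_Icc]
      omega
    · have hb : ∀ k ∈ Finset.Icc l (l + N - 1),
          ⟪v k, x⟫ ^ 2 ≤ T ^ 2 * (ρ * Ω + 2 * Ubar) ^ 2 := by
        intro k _
        rw [← sq_abs, ← mul_pow]
        refine pow_le_pow_left₀ (abs_nonneg _) ?_ 2
        refine (abs_real_inner_le_norm _ _).trans ?_
        rw [hx, mul_one, hv]
        refine (norm_add_le _ _).trans ?_
        rw [norm_smul, Real.norm_of_nonneg hT.le]
        have := mul_le_mul_of_nonneg_left (hφ k) hT.le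
        have := hw k
        linarith
      refine (Finset.sum_le_card_nsmul _ _ _ hb).trans (le_of_eq ?_)
      have hc : l + N - 1 + 1 - l = N := by omega
      rw [Nat.card_Icc, hc, nsmul_eq_mul]
      ring
  refine ⟨(lmin - D) ^ 2, _, pow_pos (by linarith) 2, ?_, rfl, key⟩
  have h := key (EuclideanSpace.single 0 1) (by simp)
  exact h.1.trans h.2
end

section
/- Let m ≥ 1 and let v : ℕ → ℝ^m be a bounded sequence (there is V > 0 with ‖v(k)‖ ≤ V for all k) satisfying the persistent excitation condition: there exist N ≥ 1 and 0 < α₁ ≤ α₂ such that for every l ∈ ℕ and every unit vector x ∈ ℝ^m, α₁ ≤ Σ_{k=l}^{l+N−1} ⟨v(k), x⟩² ≤ α₂. Let 0 < β_f < 1, let Γ(0) be a symmetric positive definite m×m real matrix, and define recursively Γ(k+1) = (1/β_f)·(Γ(k) − (Γ(k)·v(k)·v(k)ᵀ·Γ(k))/(β_f + v(k)ᵀ·Γ(k)·v(k))). Let p̃ : ℕ → ℝ^m satisfy p̃(k+1) = (I − Γ(k+1)·v(k)·v(k)ᵀ)·p̃(k). Then p̃(k) converges to 0 exponentially fast: there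 exist C ≥ 0 and λ ∈ (0,1) such that ‖p̃(k)‖ ≤ C·λ^k for all k. -/
open scoped RealInnerProductSpace Matrix

set_option maxHeartbeats 1000000

theorem rls_inv_step {m : ℕ} (G P : Matrix (Fin m) (Fin m) ℝ) (u : Fin m → ℝ) (b : ℝ) (hb : 0 < b)
    (hGP : G * P = 1) (hs : b + u ⬝ᵥ G.mulVec u ≠ 0) :
    ((1 / b) • (G - (b + u ⬝ᵥ G.mulVec u)⁻¹ • (G * Matrix.vecMulVec u u * G))) *
      (b • P + Matrix.vecMulVec u u) = 1 := by
  set W := Matrix.vecMulVec u u with hW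
  set t := u ⬝ᵥ G.mulVec u with ht
  have h1 : W * G * W = t • W := by
    rw [hW, Matrix.mul_assoc, Matrix.mul_vecMulVec, Matrix.vecMulVec_mul_vecMulVec, ← ht]
    ext i j
    simp [Matrix.vecMulVec_apply]
    ring
  have h2 : G * W * G * P = G * W := by rw [Matrix.mul_assoc, hGP, Matrix.mul_one]
  have h3 : G * W * G * W = t • (G * W) := by
    rw [Matrix.mul_assoc, Matrix.mul_assoc, ← Matrix.mul_assoc W, h1, Matrix.mul_smul]
  rw [Matrix.smul_mul, Matrix.sub_mul, Matrix.smul_mul, Matrix.mul_add, Matrix.mul_add,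
    Matrix.mul_smul, Matrix.mul_smul, hGP, h2, h3, ← add_smul, smul_smul, inv_mul_cancel₀ hs,
    one_smul, add_sub_cancel_right, smul_smul, one_div_mul_cancel hb.ne', one_smul]

theorem rls_pos_aux {m : ℕ} (G P : Matrix (Fin m) (Fin m) ℝ) (u : Fin m → ℝ)
    (hGP : G * P = 1) (hP : ∀ x : Fin m → ℝ, 0 ≤ x ⬝ᵥ P.mulVec x) :
    0 ≤ u ⬝ᵥ G.mulVec u := by
  have h := hP (G.mulVec u)
  rw [Matrix.mulVec_mulVec, mul_eq_one_comm.mp hGP, Matrix.one_mulVec, dotProduct_comm] at h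
  exact h

theorem rls_quad_step {m : ℕ} (P : Matrix (Fin m) (Fin m) ℝ) (u x : Fin m → ℝ) (b : ℝ) :
    x ⬝ᵥ (b • P + Matrix.vecMulVec u u).mulVec x = b * (x ⬝ᵥ P.mulVec x) + (u ⬝ᵥ x) ^ 2 := by
  rw [Matrix.add_mulVec, Matrix.smul_mulVec, dotProduct_add, dotProduct_smul,
    Matrix.vecMulVec_mulVec]
  simp [dotProduct_comm x u]
  ring

/-- Convergence conclusion of Theorem 1 of the paper: if the bounded sequence `v` is
persistently exciting, then the error dynamics of the recursive least-squares relative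
localization estimator with forgetting factor `β_f` converge to zero exponentially fast. -/
theorem rlse_exponential_convergence
    (m : ℕ) (hm : 1 ≤ m)
    (v : ℕ → EuclideanSpace ℝ (Fin m))
    (V : ℝ) (hV : 0 < V) (hbd : ∀ k, ‖v k‖ ≤ V)
    (N : ℕ) (hN : 1 ≤ N) (α₁ α₂ : ℝ) (hα₁ : 0 < α₁) (hα₁₂ : α₁ ≤ α₂)
    (hPE : ∀ l : ℕ, ∀ x : EuclideanSpace ℝ (Fin m), ‖x‖ = 1 →
      α₁ ≤ ∑ k ∈ Finset.Icc l (l + N - 1), ⟪v k, x⟫ ^ 2 ∧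
      ∑ k ∈ Finset.Icc l (l + N - 1), ⟪v k, x⟫ ^ 2 ≤ α₂)
    (βf : ℝ) (hβf0 : 0 < βf) (hβf1 : βf < 1)
    (Γ : ℕ → Matrix (Fin m) (Fin m) ℝ) (hΓ0sym : (Γ 0).IsSymm) (hΓ0pd : (Γ 0).PosDef)
    (hΓ : ∀ k, Γ (k + 1) = (1 / βf) •
      (Γ k - (βf + v k ⬝ᵥ (Γ k).mulVec (v k))⁻¹ •
        (Γ k * Matrix.vecMulVec (v k) (v k) * Γ k)))
    (ptil : ℕ → EuclideanSpace ℝ (Fin m))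
    (hptil : ∀ k, ptil (k + 1) =
      Matrix.toEuclideanLin (1 - Γ (k + 1) * Matrix.vecMulVec (v k) (v k)) (ptil k)) :
    ∃ C : ℝ, 0 ≤ C ∧ ∃ lam : ℝ, lam ∈ Set.Ioo (0 : ℝ) 1 ∧
      ∀ k, ‖ptil k‖ ≤ C * lam ^ k := by
  let P : ℕ → Matrix (Fin m) (Fin m) ℝ := fun k => Nat.rec (Γ 0)⁻¹
    (fun k Q => βf • Q + Matrix.vecMulVec (v k) (v k)) k
  have hP0 : P 0 = (Γ 0)⁻¹ := rfl
  have hPs : ∀ k, P (k + 1) = βf • P k + Matrix.vecMulVec (v k) (v k) := fun k => rfl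
  have hq : ∀ k (x : Fin m → ℝ), x ⬝ᵥ (P (k + 1)).mulVec x
      = βf * (x ⬝ᵥ (P k).mulVec x) + ((v k : Fin m → ℝ) ⬝ᵥ x) ^ 2 := by
    intro k x
    rw [hPs]
    exact rls_quad_step _ _ _ _
  have hpos : ∀ k (x : Fin m → ℝ), 0 ≤ x ⬝ᵥ (P k).mulVec x := by
    intro k
    induction k with
    | zero =>
      intro x
      have := hΓ0pd.inv.posSemidef.dotProduct_mulVec_nonneg x
      simpa [hP0] using this
    | succ k ih =>
      intro x
      rw [hq]
      have := ih x
      positivity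
  have hinv : ∀ k, Γ k * P k = 1 := by
    intro k
    induction k with
    | zero =>
      rw [hP0]
      exact Matrix.mul_nonsing_inv _ ((Matrix.isUnit_iff_isUnit_det _).mp hΓ0pd.isUnit)
    | succ k ih =>
      rw [hPs, hΓ]
      have := rls_pos_aux (Γ k) (P k) (v k) ih (hpos k)
      exact rls_inv_step _ _ _ _ hβf0 ih (by positivity)
  have hrec : ∀ k, (P (k + 1)).mulVec (ptil (k + 1)) = βf • (P k).mulVec (ptil k) := by
    intro k
    have h1 : (ptil (k + 1) : Fin m → ℝ)
        = (1 - Γ (k + 1) * Matrix.vecMulVec (v k) (v k)).mulVec (ptil k) := by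
      rw [hptil]; rfl
    rw [h1, Matrix.mulVec_mulVec, Matrix.mul_sub, ← Matrix.mul_assoc,
      mul_eq_one_comm.mp (hinv (k + 1)), Matrix.mul_one, Matrix.one_mul, hPs,
      add_sub_cancel_right, Matrix.smul_mulVec]
  set w : Fin m → ℝ := (P 0).mulVec (ptil 0) with hw
  have hclosed : ∀ k, (P k).mulVec (ptil k) = βf ^ k • w := by
    intro k
    induction k with
    | zero => simp [hw]
    | succ k ih => rw [hrec, ih, smul_smul, pow_succ']
  have hlow : ∀ l n (x : Fin m → ℝ),
      βf ^ n * ∑ k ∈ Finset.Ico l (l + n), ((v k : Fin m → ℝ) ⬝ᵥ x) ^ 2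
        ≤ x ⬝ᵥ (P (l + n)).mulVec x := by
    intro l n x
    induction n with
    | zero => simpa using hpos l x
    | succ n ih =>
      rw [← add_assoc, hq, Finset.sum_Ico_succ_top (by omega), mul_add, pow_succ']
      have h1 := mul_le_mul_of_nonneg_left ih hβf0.le
      have h2 : βf * βf ^ n * ((v (l + n) : Fin m → ℝ) ⬝ᵥ x) ^ 2
          ≤ 1 * ((v (l + n) : Fin m → ℝ) ⬝ᵥ x) ^ 2 := by
        gcongr
        rw [← pow_succ']
        exact pow_le_one₀ hβf0.le hβf1.le
      linarith
  have hin : ∀ a b : EuclideanSpace ℝ (Fin m), ⟪a, b⟫ = (a : Fin m → ℝ) ⬝ᵥ (b : Fin m → ℝ) := by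
    intro a b
    rw [EuclideanSpace.inner_eq_star_dotProduct, dotProduct_comm]
    simp
  have hPE' : ∀ l (x : EuclideanSpace ℝ (Fin m)),
      α₁ * ‖x‖ ^ 2 ≤ ∑ k ∈ Finset.Ico l (l + N), ((v k : Fin m → ℝ) ⬝ᵥ x) ^ 2 := by
    intro l x
    rcases eq_or_ne x 0 with rfl | hx
    · simp
    have hx' : 0 < ‖x‖ := norm_pos_iff.mpr hx
    have h := (hPE l (‖x‖⁻¹ • x) (by rw [norm_smul, norm_inv, norm_norm, inv_mul_cancel₀ hx'.ne'])).1
    have hI : Finset.Icc l (l + N - 1) = Finset.Ico l (l + N) := by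
      ext k; simp; omega
    simp_rw [hI, inner_smul_right, mul_pow, hin] at h
    rw [← Finset.mul_sum, inv_pow, ← div_eq_inv_mul, le_div_iff₀ (by positivity)] at h
    exact h
  set c := βf ^ N * α₁ with hc
  have hc0 : 0 < c := by positivity
  have hbig : ∀ l, ‖ptil (l + N)‖ ≤ ‖WithLp.toLp 2 w‖ / c * βf ^ (l + N) := by
    intro l
    set x := ptil (l + N) with hx
    have h1 := hlow l N x
    have h2 := mul_le_mul_of_nonneg_left (hPE' l x) (pow_nonneg hβf0.le N)
    have h3 := hclosed (l + N)
    rw [← hx] at h3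
    rw [h3, dotProduct_smul, smul_eq_mul] at h1
    have h4 : (x : Fin m → ℝ) ⬝ᵥ w ≤ ‖x‖ * ‖WithLp.toLp 2 w‖ := by
      have := real_inner_le_norm x (WithLp.toLp 2 w)
      rwa [hin] at this
    have h5 := mul_le_mul_of_nonneg_left h4 (pow_nonneg hβf0.le (l + N))
    rw [div_mul_eq_mul_div, le_div_iff₀ hc0]
    rcases (norm_nonneg x).eq_or_lt with h0 | h0
    · rw [← h0]; simp; positivity
    · refine le_of_mul_le_mul_left ?_ h0
      rw [hc]
      nlinarith
  have hS : 0 ≤ ∑ k ∈ Finset.range N, ‖ptil k‖ / βf ^ k :=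
    Finset.sum_nonneg fun k _ => by positivity
  have hT : 0 ≤ ‖WithLp.toLp 2 w‖ / c := by positivity
  refine ⟨∑ k ∈ Finset.range N, ‖ptil k‖ / βf ^ k + ‖WithLp.toLp 2 w‖ / c, add_nonneg hS hT,
    βf, ⟨hβf0, hβf1⟩, fun k => ?_⟩
  have hk : 0 < βf ^ k := by positivity
  rcases lt_or_ge k N with h | h
  · rw [← div_le_iff₀ hk]
    have := Finset.single_le_sum (f := fun k => ‖ptil k‖ / βf ^ k)
      (fun k _ => by positivity) (Finset.mem_range.mpr h)
    linarith
  · obtain ⟨l, rfl⟩ := Nat.exists_eq_add_of_le' h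
    refine (hbig l).trans ?_
    gcongr
    linarith
end

section
/- Let n ≥ 2, let T, ω, θ₀ be real numbers, and let K₁, …, K_n be real numbers. Define θ_i(k) = θ₀ + kTω + 2πi/n for i ∈ {1, …, n} and k ∈ ℕ. Then this evenly spaced (splay) configuration satisfies the coupled-oscillator recursion with complete-graph weights a_ij = 1/(n−1) for i ≠ j: for every i and every k, θ_i(k+1) = θ_i(k) + Tω + T·Σ_{j=1, j≠i}^{n} Σ_{l=1}^{n} (K_l/((n−1)·l))·sin(l·(θ_i(k) − θ_j(k))). -/
theorem odd_periodic_sum (g : ℝ → ℝ) (n : ℕ) (hp : ∀ x, g (x - n) = g x)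
    (ho : ∀ x, g (-x) = - g x) (i : ℕ) :
    ∑ j ∈ Finset.range n, g ((i : ℝ) - ((j : ℝ) + 1)) = 0 := by
  induction i with
  | zero =>
    have h1 : ∑ j ∈ Finset.range n, g (((0 : ℕ) : ℝ) - ((j : ℝ) + 1))
        = ∑ j ∈ Finset.range n, g (j : ℝ) := by
      rw [← Finset.sum_range_reflect]
      refine Finset.sum_congr rfl fun j hj => ?_
      have hj' := Finset.mem_range.1 hj
      rw [← hp (j : ℝ)]
      congr 1
      have : ((n - 1 - j : ℕ) : ℝ) = (n : ℝ) - 1 - j := by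
        rw [Nat.sub_sub, Nat.cast_sub (by omega)]; push_cast; ring
      rw [this]; push_cast; ring
    have h2 : ∑ j ∈ Finset.range n, g (((0 : ℕ) : ℝ) - ((j : ℝ) + 1))
        = - ∑ j ∈ Finset.range n, g ((j : ℝ) + 1) := by
      rw [← Finset.sum_neg_distrib]
      refine Finset.sum_congr rfl fun j _ => ?_
      rw [← ho]; congr 1; push_cast; ring
    have h3 := Finset.sum_range_succ (fun j : ℕ => g (j : ℝ)) n
    have h4 := Finset.sum_range_succ' (fun j : ℕ => g (j : ℝ)) n
    have h5 := hp n
    rw [sub_self] at h5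
    push_cast at h4
    linarith
  | succ i ih =>
    have h3 := Finset.sum_range_succ (fun j : ℕ => g ((i : ℝ) - (j : ℝ))) n
    have h4 := Finset.sum_range_succ' (fun j : ℕ => g ((i : ℝ) - (j : ℝ))) n
    have h5 := hp i
    have h6 : ∑ j ∈ Finset.range n, g (((i + 1 : ℕ) : ℝ) - ((j : ℝ) + 1))
        = ∑ j ∈ Finset.range n, g ((i : ℝ) - (j : ℝ)) := by
      refine Finset.sum_congr rfl fun j _ => ?_
      congr 1; push_cast; ring
    push_cast at h4
    rw [sub_zero] at h4
    linarith

/-- The evenly spaced (splay) configuration `θ_i(k) = θ₀ + kTω + 2πi/n` satisfies the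
discrete-time coupled Kuramoto recursion (8) of the paper with complete-graph weights
`a_ij = 1/(n-1)`: every coupling term vanishes and each phase advances by `Tω`
(the equilibrium claim underlying Lemma 1 of the paper). -/
theorem splay_is_kuramoto_equilibrium
    (n : ℕ) (hn : 2 ≤ n) (T ω θ₀ : ℝ) (K : ℕ → ℝ)
    (θ : ℕ → ℕ → ℝ)
    (hθ : ∀ i k, θ i k = θ₀ + k * T * ω + 2 * Real.pi * i / n) :
    ∀ i ∈ Finset.Icc 1 n, ∀ k : ℕ,
      θ i (k + 1) = θ i k + T * ω +
        T * ∑ j ∈ (Finset.Icc 1 n).erase i, ∑ l ∈ Finset.Icc 1 n,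
          (K l / (((n : ℝ) - 1) * l)) * Real.sin (l * (θ i k - θ j k)) := by
  intro i hi k
  have hn0 : (n : ℝ) ≠ 0 := by
    have : n ≠ 0 := by omega
    exact_mod_cast this
  have key : ∀ l : ℕ, ∑ j ∈ (Finset.Icc 1 n).erase i, Real.sin (l * (θ i k - θ j k)) = 0 := by
    intro l
    rw [Finset.sum_erase _ (by simp)]
    have h := odd_periodic_sum (fun x => Real.sin (l * (2 * Real.pi * x / n))) n
      (by
        intro x
        have : (l : ℝ) * (2 * Real.pi * (x - n) / n)
            = l * (2 * Real.pi * x / n) - l * (2 * Real.pi) := by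
          field_simp
        simp only [this, Real.sin_sub_nat_mul_two_pi])
      (by
        intro x
        simp only [← Real.sin_neg]
        congr 1; ring) i
    rw [← h, Finset.range_eq_Ico, ← Finset.Ico_add_one_right_eq_Icc,
      Finset.sum_Ico_eq_sum_range, ← Finset.range_eq_Ico]
    simp only [Nat.add_sub_cancel]
    refine Finset.sum_congr rfl fun j _ => ?_
    rw [hθ, hθ]
    congr 1; push_cast; ring
  rw [Finset.sum_comm]
  simp only [← Finset.mul_sum, key, mul_zero, Finset.sum_const_zero]
  rw [hθ, hθ]; push_cast; ring
end

section
/- Let n ≥ 1 and let Λ and Λ' be n×n real matrices with nonnegative entries whose row sums are all at most 1. Fix an index i and suppose η ∈ [0, 1) is such that the i-th row sum of Λ satisfies Σ_m Λ_{im} ≤ η. If j is an index with Λ'_{ji} ≥ γ for some γ > 0, then the j-th entry of Λ'·Λ·𝟙 satisfies (Λ'·Λ·𝟙)_j ≤ 1 − γ·(1 − η) < 1, where 𝟙 ∈ ℝⁿ is the all-ones vector. -/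
/-- Two-step contraction estimate from the proof of Theorem 2 of the paper: if the `i`-th
row sum of the nonnegative substochastic matrix `Λ` is at most `η < 1` and `Λ'_{ji} ≥ γ > 0`,
then the `j`-th entry of `Λ' Λ 𝟙` is at most `1 - γ(1-η) < 1`. -/
theorem two_step_row_sum_contraction
    (n : ℕ) (hn : 1 ≤ n)
    (Λ Λ' : Matrix (Fin n) (Fin n) ℝ)
    (hΛ : ∀ i j, 0 ≤ Λ i j) (hΛ' : ∀ i j, 0 ≤ Λ' i j)
    (hrow : ∀ i, ∑ j, Λ i j ≤ 1) (hrow' : ∀ i, ∑ j, Λ' i j ≤ 1)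
    (i : Fin n) (η : ℝ) (hη0 : 0 ≤ η) (hη1 : η < 1) (hi : ∑ m, Λ i m ≤ η)
    (j : Fin n) (γ : ℝ) (hγ : 0 < γ) (hji : γ ≤ Λ' j i) :
    (Λ' * Λ).mulVec (fun _ => 1) j ≤ 1 - γ * (1 - η) ∧ 1 - γ * (1 - η) < 1 := by
  constructor
  · have h1 : (Λ' * Λ).mulVec (fun _ => 1) j = ∑ m, Λ' j m * ∑ k, Λ m k := by
      rw [← Matrix.mulVec_mulVec]
      simp [Matrix.mulVec, dotProduct]
    have h2 : Λ' j i * (1 - ∑ k, Λ i k) ≤ ∑ m, Λ' j m * (1 - ∑ k, Λ m k) :=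
      Finset.single_le_sum (f := fun m => Λ' j m * (1 - ∑ k, Λ m k))
        (fun m _ => mul_nonneg (hΛ' j m) (sub_nonneg.2 (hrow m))) (Finset.mem_univ i)
    have h3 : γ * (1 - η) ≤ Λ' j i * (1 - ∑ k, Λ i k) :=
      mul_le_mul hji (by linarith) (by linarith) (hΛ' j i)
    have h4 := hrow' j
    simp only [mul_sub, mul_one, Finset.sum_sub_distrib] at h2 h3
    rw [h1]
    linarith
  · have := mul_pos hγ (sub_pos.2 hη1)
    linarith
end

section
/- Let n ≥ 1, δ ≥ 0, and λ ∈ [0, 1). Let P : ℕ → (Fin n → ℝ) be a sequence of entrywise nonnegative vectors and Λ : ℕ → (n×n real matrices) a sequence of entrywise nonnegative matrices each of whose row sums is at most 1. Assume: (a) P(k+1)_i ≤ (Λ(k)·P(k))_i + δ·λ^k for all i and k, and (b) there exists η ∈ (0, 1) such that for all k and all i, (Λ(k+1)·Λ(k)·𝟙)_i ≤ η, where 𝟙 is the all-ones vector. Then there exist C ≥ 0 and μ ∈ (0, 1) such that max_i P(k)_i ≤ C·μ^k for all k; in particular max_i P(k)_i → 0 as k → ∞. -/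
/-- Abstract form of Theorem 2 of the paper: if the entrywise nonnegative per-UAV error
vectors `P k` satisfy `P(k+1) ≤ Λ(k) P(k) + δ λ^k` entrywise with nonnegative
substochastic matrices `Λ k`, and the two-step products satisfy the uniform row-sum
contraction `(Λ(k+1) Λ(k) 𝟙)_i ≤ η < 1`, then `max_i P(k)_i` converges to zero
exponentially fast. -/
theorem formation_tracking_exponential_convergence
    (n : ℕ) (hn : 0 < n) (δ lam : ℝ) (hδ : 0 ≤ δ) (hlam0 : 0 ≤ lam) (hlam1 : lam < 1)
    (P : ℕ → Fin n → ℝ) (hP : ∀ k i, 0 ≤ P k i)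
    (Λ : ℕ → Matrix (Fin n) (Fin n) ℝ)
    (hΛ : ∀ k i j, 0 ≤ Λ k i j) (hrow : ∀ k i, ∑ j, Λ k i j ≤ 1)
    (hrec : ∀ k i, P (k + 1) i ≤ (Λ k).mulVec (P k) i + δ * lam ^ k)
    (η : ℝ) (hη : η ∈ Set.Ioo (0 : ℝ) 1)
    (hcontr : ∀ k i, (Λ (k + 1) * Λ k).mulVec (fun _ => 1) i ≤ η) :
    ∃ C : ℝ, 0 ≤ C ∧ ∃ μ : ℝ, μ ∈ Set.Ioo (0 : ℝ) 1 ∧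
      ∀ k, Finset.univ.sup' ⟨⟨0, hn⟩, Finset.mem_univ _⟩ (P k) ≤ C * μ ^ k := by
  obtain ⟨hη0, hη1⟩ := hη
  have step : ∀ k B, 0 ≤ B → (∀ i, P k i ≤ B) → ∀ i, P (k + 2) i ≤ η * B + 2 * δ * lam ^ k := by
    intro k B hB hPB i
    have hc := hcontr k i
    rw [← Matrix.mulVec_mulVec] at hc
    have hlk : 0 ≤ lam ^ k := pow_nonneg hlam0 k
    have hD : 0 ≤ δ * lam ^ k := mul_nonneg hδ hlk
    have h1 : ∀ j, P (k + 1) j ≤ (Λ k).mulVec (fun _ => 1) j * B + δ * lam ^ k := by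
      intro j
      refine (hrec k j).trans ?_
      gcongr
      simp only [Matrix.mulVec, dotProduct, mul_one]
      rw [Finset.sum_mul]
      exact Finset.sum_le_sum fun l _ => mul_le_mul_of_nonneg_left (hPB l) (hΛ k j l)
    have h2 : (Λ (k + 1)).mulVec (P (k + 1)) i
        ≤ (Λ (k + 1)).mulVec ((Λ k).mulVec (fun _ => 1)) i * B
          + (∑ j, Λ (k + 1) i j) * (δ * lam ^ k) := by
      generalize (Λ k).mulVec (fun _ => 1) = v at *
      simp only [Matrix.mulVec, dotProduct]
      rw [Finset.sum_mul, Finset.sum_mul, ← Finset.sum_add_distrib]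
      refine Finset.sum_le_sum fun l _ => ?_
      have := mul_le_mul_of_nonneg_left (h1 l) (hΛ (k + 1) i l)
      linarith
    have h3 := hrec (k + 1) i
    have h4 := mul_le_mul_of_nonneg_right hc hB
    have h5 := mul_le_mul_of_nonneg_right (hrow (k + 1) i) hD
    have h6 : δ * lam ^ (k + 1) ≤ δ * lam ^ k := by
      rw [pow_succ]
      nlinarith
    have h7 : P (k + 2) i = P (k + 1 + 1) i := rfl
    linarith
  obtain ⟨μ, hμ⟩ : ∃ μ, μ = max ((1 + η) / 2) lam := ⟨_, rfl⟩
  have hμa : (1 + η) / 2 ≤ μ := hμ ▸ le_max_left _ _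
  have hμl : lam ≤ μ := hμ ▸ le_max_right _ _
  have hμ0 : 0 < μ := by linarith
  have hμ1 : μ < 1 := by rw [hμ]; exact max_lt (by linarith) hlam1
  obtain ⟨g, hg⟩ : ∃ g, g = ((1 - η) / 2) ^ 2 := ⟨_, rfl⟩
  have hg0 : 0 < g := by rw [hg]; have : 0 < 1 - η := by linarith
                         positivity
  have hgap : η + g ≤ μ ^ 2 := by rw [hg]; nlinarith
  have hS0 : 0 ≤ ∑ i, P 0 i := Finset.sum_nonneg fun i _ => hP 0 i
  have hS1 : 0 ≤ (∑ i, P 1 i) / μ := div_nonneg (Finset.sum_nonneg fun i _ => hP 1 i) hμ0.le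
  have hS2 : 0 ≤ 2 * δ / g := by positivity
  obtain ⟨C, hC⟩ : ∃ C, C = ∑ i, P 0 i + (∑ i, P 1 i) / μ + 2 * δ / g := ⟨_, rfl⟩
  have hC0 : 0 ≤ C := by rw [hC]; positivity
  have hCg : 2 * δ ≤ C * g := by
    rw [← div_le_iff₀ hg0]; linarith
  have key : ∀ k, (∀ i, P k i ≤ C * μ ^ k) ∧ (∀ i, P (k + 1) i ≤ C * μ ^ (k + 1)) := by
    intro k
    induction k with
    | zero =>
      constructor
      · intro i
        have := Finset.single_le_sum (fun j _ => hP 0 j) (Finset.mem_univ i)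
        rw [pow_zero, mul_one]; linarith
      · intro i
        have := Finset.single_le_sum (fun j _ => hP 1 j) (Finset.mem_univ i)
        rw [zero_add, pow_one, ← div_le_iff₀ hμ0]
        have := div_le_div_of_nonneg_right this hμ0.le
        linarith
    | succ k ih =>
      refine ⟨ih.2, fun i => ?_⟩
      have hμk : 0 ≤ μ ^ k := pow_nonneg hμ0.le k
      have h1 := step k (C * μ ^ k) (mul_nonneg hC0 hμk) ih.1 i
      have h2 : lam ^ k ≤ μ ^ k := pow_le_pow_left₀ hlam0 hμl k
      have h3 : 2 * δ * lam ^ k ≤ C * g * μ ^ k :=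
        mul_le_mul hCg h2 (pow_nonneg hlam0 k) (by positivity)
      have h4 := mul_le_mul_of_nonneg_left hgap (mul_nonneg hC0 hμk)
      have h5 : C * μ ^ (k + 1 + 1) = C * μ ^ k * μ ^ 2 := by ring
      have h7 : P (k + 2) i = P (k + 1 + 1) i := rfl
      rw [h5]
      linarith
  exact ⟨C, hC0, μ, ⟨hμ0, hμ1⟩, fun k => Finset.sup'_le _ _ fun i _ => (key k).1 i⟩
end
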